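/- arXiv:1801.05973 — 4 statements merged into one kernel-verified Lean document; each statement's English description precedes it below -/
import Mathlib

section
/- For every n ≥ 1 and every irreducible permutation σ of {1,…,n}, the permutations L(σ) and R(σ) are irreducible, and moreover L(σ)(n) = σ(n) and R(σ)⁻¹(1) = σ⁻¹(1). Consequently L and R restrict to bijections of the (finite) set of irreducible permutations of {1,…,n}. -/
open scoped Classical

namespace Rauzy

/-- The initial block `{0,…,i-1}` of `Fin n` as a subtype. -/
def blockEquiv (n i : ℕ) (h : i ≤ n) : Fin i ≃ {j : Fin n // j.val < i} where
  toFun x := ⟨⟨x.val, lt_of_lt_of_le x.isLt h⟩, x.isLt⟩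
  invFun x := ⟨x.1.val, x.2⟩
  left_inv _ := rfl
  right_inv _ := rfl

/-- The final block `{a,…,n-1}` of `Fin n` as a subtype. -/
def tailEquiv (n a : ℕ) (h : a ≤ n) : Fin (n - a) ≃ {j : Fin n // a ≤ j.val} where
  toFun x := ⟨⟨a + x.val, by have := x.isLt; omega⟩, by simp⟩
  invFun x := ⟨x.1.val - a, by have := x.1.isLt; have := x.2; omega⟩
  left_inv x := by apply Fin.ext; simp
  right_inv x := by apply Subtype.ext; apply Fin.ext; have := x.2; simp; omega

/-- Cyclically rotate the first `i` elements of `Fin n` down by one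
(`0 ↦ i-1`, `j ↦ j-1` for `1 ≤ j ≤ i-1`), fixing the others. -/
def rotDownBelow (n i : ℕ) (h : i ≤ n) : Equiv.Perm (Fin n) :=
  Equiv.Perm.extendDomain (finRotate i)⁻¹ (blockEquiv n i h)

/-- Cyclically rotate the last `n - a` elements of `Fin n` down by one
(`a ↦ n-1`, `j ↦ j-1` for `a+1 ≤ j ≤ n-1`), fixing the others. -/
def rotDownFrom (n a : ℕ) (h : a ≤ n) : Equiv.Perm (Fin n) :=
  Equiv.Perm.extendDomain (finRotate (n - a))⁻¹ (tailEquiv n a h)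

/-- The Rauzy operator `L`: `L(σ) = γ_L(σ(n)) ∘ σ`. -/
def rauzyL {n : ℕ} (σ : Equiv.Perm (Fin n)) : Equiv.Perm (Fin n) :=
  if h : 0 < n then
    rotDownBelow n (σ ⟨n - 1, by omega⟩).val (σ ⟨n - 1, by omega⟩).isLt.le * σ
  else σ

/-- The Rauzy operator `R`: `R(σ) = σ ∘ δ_R(σ⁻¹(1))`. -/
def rauzyR {n : ℕ} (σ : Equiv.Perm (Fin n)) : Equiv.Perm (Fin n) :=
  if h : 0 < n then σ * rotDownFrom n ((σ⁻¹ ⟨0, h⟩).val + 1) (σ⁻¹ ⟨0, h⟩).isLt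
  else σ

/-- A permutation `σ` of `{1,…,n}` (0-based: `Fin n`) is irreducible if it maps no initial
segment `{1,…,k}` (with `k < n`) onto the final segment `{n-k+1,…,n}`. -/
def rauzyIrreducible {n : ℕ} (σ : Equiv.Perm (Fin n)) : Prop :=
  ∀ k : ℕ, 1 ≤ k → k < n →
    Finset.image (fun j => σ j) (Finset.univ.filter fun j : Fin n => j.val < k) ≠
      Finset.univ.filter fun j : Fin n => n - k ≤ j.val

theorem rotDownBelow_apply_of_le {n i : ℕ} (h : i ≤ n) {v : Fin n} (hv : i ≤ v.val) :
    rotDownBelow n i h v = v :=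
  Equiv.Perm.extendDomain_apply_not_subtype _ _ (by simpa using hv)

theorem rotDownFrom_apply_of_lt {n a : ℕ} (h : a ≤ n) {j : Fin n} (hj : j.val < a) :
    rotDownFrom n a h j = j :=
  Equiv.Perm.extendDomain_apply_not_subtype _ _ (by simpa using hj)

/-- A permutation fixing every point outside `p` preserves every predicate implied by `p`. -/
theorem perm_apply_iff_of_forall_fixed {α : Type*} {f : Equiv.Perm α} {p : α → Prop}
    (hf : ∀ x, ¬ p x → f x = x) {q : α → Prop} (hpq : ∀ x, p x → q x) (x : α) :
    q (f x) ↔ q x := by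
  by_cases hx : p x
  · refine iff_of_true ?_ (hpq x hx)
    by_cases hfx : p (f x)
    · exact hpq _ hfx
    · exact (f.injective (hf _ hfx)).symm ▸ hpq x hx
  · rw [hf x hx]

theorem rotDownBelow_apply_lt_iff {n i m : ℕ} (h : i ≤ n) (him : i ≤ m) (v : Fin n) :
    (rotDownBelow n i h v).val < m ↔ v.val < m :=
  perm_apply_iff_of_forall_fixed (p := fun v : Fin n => v.val < i) (q := fun v => v.val < m)
    (fun _ hx => rotDownBelow_apply_of_le h (not_lt.mp hx)) (fun _ hx => hx.trans_le him) v

theorem le_rotDownFrom_apply_iff {n a m : ℕ} (h : a ≤ n) (hma : m ≤ a) (j : Fin n) :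
    m ≤ (rotDownFrom n a h j).val ↔ m ≤ j.val :=
  perm_apply_iff_of_forall_fixed (p := fun v : Fin n => a ≤ v.val) (q := fun v => m ≤ v.val)
    (fun _ hx => rotDownFrom_apply_of_lt h (not_le.mp hx)) (fun _ hx => hma.trans hx) j

theorem image_eq_tail_iff {n k : ℕ} (σ : Equiv.Perm (Fin n)) :
    Finset.image (fun j => σ j) (Finset.univ.filter fun j : Fin n => j.val < k) =
      (Finset.univ.filter fun j : Fin n => n - k ≤ j.val) ↔
    ∀ j : Fin n, j.val < k ↔ n - k ≤ (σ j).val := by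
  rw [Finset.ext_iff, ← σ.forall_congr_right]
  simp

theorem rauzyIrreducible_iff {n : ℕ} (σ : Equiv.Perm (Fin n)) :
    rauzyIrreducible σ ↔
      ∀ k : ℕ, 1 ≤ k → k < n → ¬ ∀ j : Fin n, j.val < k ↔ n - k ≤ (σ j).val := by
  simp only [rauzyIrreducible, ne_eq, image_eq_tail_iff]

theorem rauzyL_apply_last {n : ℕ} (hn : 1 ≤ n) (σ : Equiv.Perm (Fin n)) :
    rauzyL σ ⟨n - 1, Nat.sub_one_lt_of_lt hn⟩ = σ ⟨n - 1, Nat.sub_one_lt_of_lt hn⟩ := by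
  rw [rauzyL, dif_pos (Nat.lt_of_succ_le hn)]
  exact rotDownBelow_apply_of_le _ le_rfl

theorem rauzyR_apply_inv_zero {n : ℕ} (hn : 1 ≤ n) (σ : Equiv.Perm (Fin n)) :
    rauzyR σ (σ⁻¹ ⟨0, hn⟩) = ⟨0, hn⟩ := by
  rw [rauzyR, dif_pos (Nat.lt_of_succ_le hn), Equiv.Perm.mul_apply,
    rotDownFrom_apply_of_lt _ (Nat.lt_succ_self _)]
  exact σ.apply_symm_apply _

theorem rauzyR_inv_apply_zero {n : ℕ} (hn : 1 ≤ n) (σ : Equiv.Perm (Fin n)) :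
    (rauzyR σ)⁻¹ ⟨0, hn⟩ = σ⁻¹ ⟨0, hn⟩ :=
  Equiv.Perm.inv_eq_iff_eq.mpr (rauzyR_apply_inv_zero hn σ).symm

theorem rauzyIrreducible_rauzyL {n : ℕ} (hn : 1 ≤ n) {σ : Equiv.Perm (Fin n)}
    (hσ : rauzyIrreducible σ) : rauzyIrreducible (rauzyL σ) := by
  rw [rauzyIrreducible_iff] at hσ ⊢
  intro k hk hkn hred
  have hlast := hred ⟨n - 1, Nat.sub_one_lt_of_lt hn⟩
  rw [rauzyL_apply_last hn] at hlast
  refine hσ k hk hkn fun j => (hred j).trans ?_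
  rw [rauzyL, dif_pos (Nat.lt_of_succ_le hn), Equiv.Perm.mul_apply, ← not_lt, ← not_lt,
    rotDownBelow_apply_lt_iff _ (by dsimp only at hlast; omega)]

theorem rauzyIrreducible_rauzyR {n : ℕ} (hn : 1 ≤ n) {σ : Equiv.Perm (Fin n)}
    (hσ : rauzyIrreducible σ) : rauzyIrreducible (rauzyR σ) := by
  rw [rauzyIrreducible_iff] at hσ ⊢
  intro k hk hkn hred
  have hzero := hred (σ⁻¹ ⟨0, hn⟩)
  rw [rauzyR_apply_inv_zero hn] at hzero
  refine hσ k hk hkn fun j => ?_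
  obtain ⟨j, rfl⟩ :=
    (rotDownFrom n ((σ⁻¹ ⟨0, hn⟩).val + 1) (σ⁻¹ ⟨0, hn⟩).isLt).surjective j
  have hj := hred j
  rw [rauzyR, dif_pos (Nat.lt_of_succ_le hn), Equiv.Perm.mul_apply] at hj
  rw [← hj, ← not_le, ← not_le,
    le_rotDownFrom_apply_iff _ (by dsimp only at hzero; omega)]

theorem rauzyL_injective {n : ℕ} (hn : 1 ≤ n) :
    Function.Injective (rauzyL : Equiv.Perm (Fin n) → Equiv.Perm (Fin n)) := by
  intro σ τ h
  have hlast := rauzyL_apply_last hn σ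
  rw [h, rauzyL_apply_last hn] at hlast
  simp only [rauzyL, dif_pos (show 0 < n from hn), hlast] at h
  exact mul_left_cancel h

theorem rauzyR_injective {n : ℕ} (hn : 1 ≤ n) :
    Function.Injective (rauzyR : Equiv.Perm (Fin n) → Equiv.Perm (Fin n)) := by
  intro σ τ h
  have hzero := rauzyR_inv_apply_zero hn σ
  rw [h, rauzyR_inv_apply_zero hn] at hzero
  simp only [rauzyR, dif_pos (show 0 < n from hn), hzero] at h
  exact mul_right_cancel h

/-- For irreducible `σ`, `L(σ)` and `R(σ)` are irreducible, `L(σ)(n) = σ(n)`,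
`R(σ)⁻¹(1) = σ⁻¹(1)`; consequently `L` and `R` restrict to bijections of the set of
irreducible permutations of `{1,…,n}`. -/
theorem rauzyLR_preserve_irreducible {n : ℕ} (hn : 1 ≤ n) :
    (∀ σ : Equiv.Perm (Fin n), rauzyIrreducible σ →
      rauzyIrreducible (rauzyL σ) ∧ rauzyIrreducible (rauzyR σ) ∧
      rauzyL σ ⟨n - 1, by omega⟩ = σ ⟨n - 1, by omega⟩ ∧
      (rauzyR σ)⁻¹ ⟨0, by omega⟩ = σ⁻¹ ⟨0, by omega⟩) ∧
    Set.BijOn rauzyL {σ : Equiv.Perm (Fin n) | rauzyIrreducible σ}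
      {σ : Equiv.Perm (Fin n) | rauzyIrreducible σ} ∧
    Set.BijOn rauzyR {σ : Equiv.Perm (Fin n) | rauzyIrreducible σ}
      {σ : Equiv.Perm (Fin n) | rauzyIrreducible σ} := by
  have hL : ∀ σ : Equiv.Perm (Fin n), rauzyIrreducible σ → rauzyIrreducible (rauzyL σ) :=
    fun _ => rauzyIrreducible_rauzyL hn
  have hR : ∀ σ : Equiv.Perm (Fin n), rauzyIrreducible σ → rauzyIrreducible (rauzyR σ) :=
    fun _ => rauzyIrreducible_rauzyR hn
  exact ⟨fun σ hσ => ⟨hL σ hσ, hR σ hσ, rauzyL_apply_last hn σ, rauzyR_inv_apply_zero hn σ⟩,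
    ((Set.toFinite _).injOn_iff_bijOn_of_mapsTo hL).mp (rauzyL_injective hn).injOn,
    ((Set.toFinite _).injOn_iff_bijOn_of_mapsTo hR).mp (rauzyR_injective hn).injOn⟩

end Rauzy
end

section
/- For every n ≥ 2 and every irreducible permutation σ of {1,…,n}: the rank satisfies r(σ) ≥ 1, every part of λ(σ) is a positive integer, and the dimension formula r(σ) + Σ_{c ∈ λ(σ)} c = n − 1 holds. -/
open scoped Classical

namespace Rauzy

/-- The permutation of the set of "top arcs plus rank-path marker" obtained by following
the paths of the cycle-invariant construction: `0` stands for the (closed-up) rank path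
marker and `j ≥ 1` for the top arc between top endpoints `j` and `j+1` (1-based). -/
def cycleMap : {n : ℕ} → Equiv.Perm (Fin n) → Equiv.Perm (Fin n)
  | 0, _ => 1
  | (n + 1), σ =>
      finRotate (n + 1) * Equiv.swap (σ 0) (Fin.last n) * σ * finRotate (n + 1) * σ⁻¹

/-- The rank `r(σ)`: the number of top arcs on the open (rank) path. -/
noncomputable def rauzyRank : {n : ℕ} → Equiv.Perm (Fin n) → ℕ
  | 0, _ => 0
  | (_ + 1), σ => Set.ncard {x | (cycleMap σ).SameCycle 0 x} - 1

/-- The cycle structure `λ(σ)`: the multiset of the lengths (numbers of top arcs) of the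
closed cycles of the cycle-invariant construction. -/
noncomputable def rauzyLambda : {n : ℕ} → Equiv.Perm (Fin n) → Multiset ℕ
  | 0, _ => 0
  | (_ + 1), σ =>
      (Finset.univ.filter fun j =>
          (∀ x, (cycleMap σ).SameCycle j x → j ≤ x) ∧ ¬ (cycleMap σ).SameCycle 0 j).val.map
        fun j => Set.ncard {x | (cycleMap σ).SameCycle j x}

/-- The cycles of a permutation of a finite linear order that avoid `a`, each represented by its
least element, exhaust the points outside the cycle of `a`. -/
theorem ncard_sameCycle_add_sum {α : Type*} [Fintype α] [LinearOrder α] (f : Equiv.Perm α)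
    (a : α) :
    Set.ncard {x | f.SameCycle a x} +
      ∑ j ∈ Finset.univ.filter (fun j =>
        (∀ x, f.SameCycle j x → j ≤ x) ∧ ¬ f.SameCycle a j), Set.ncard {x | f.SameCycle j x} =
      Fintype.card α := by
  have hcard (j : α) : Set.ncard {x | f.SameCycle j x} =
      (Finset.univ.filter fun x => f.SameCycle j x).card := by
    rw [← Set.ncard_coe_finset]
    simp
  simp only [hcard]
  rw [← Finset.card_biUnion, ← Finset.card_univ,
    ← Finset.card_filter_add_card_filter_not (s := Finset.univ) (fun x => f.SameCycle a x)]
  · congr 2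
    ext x
    simp only [Finset.mem_biUnion, Finset.mem_filter, Finset.mem_univ, true_and]
    constructor
    · rintro ⟨j, ⟨-, haj⟩, hjx⟩ hax
      exact haj (hax.trans hjx.symm)
    · intro hax
      obtain ⟨j, hj, hmin⟩ := (Finset.univ.filter fun y => f.SameCycle x y).exists_min_image id
        ⟨x, by simp [Equiv.Perm.SameCycle.refl]⟩
      simp only [Finset.mem_filter, Finset.mem_univ, true_and, id] at hj hmin
      exact ⟨j, ⟨fun y hy => hmin y (hj.trans hy), fun haj => hax (haj.trans hj.symm)⟩, hj.symm⟩
  · intro i hi j hj hij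
    simp only [Finset.coe_filter, Finset.mem_univ, true_and, Set.mem_ofPred_eq] at hi hj
    rw [Function.onFun, Finset.disjoint_left]
    intro x hix hjx
    simp only [Finset.mem_filter, Finset.mem_univ, true_and] at hix hjx
    exact hij (le_antisymm (hi.1 j (hix.trans hjx.symm)) (hj.1 i (hjx.trans hix.symm)))

theorem cycleMap_zero_eq_zero_iff {n : ℕ} (σ : Equiv.Perm (Fin (n + 1))) :
    cycleMap σ 0 = 0 ↔ σ (Fin.last n) = 0 := by
  have hrot (x : Fin (n + 1)) : finRotate (n + 1) x = 0 ↔ x = Fin.last n := by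
    rw [← finRotate_last, (finRotate (n + 1)).injective.eq_iff]
  simp only [cycleMap, Equiv.Perm.mul_apply]
  rw [hrot, Equiv.swap_apply_eq_iff, Equiv.swap_apply_right, σ.injective.eq_iff, hrot,
    Equiv.Perm.inv_eq_iff_eq, eq_comm]

theorem rauzyIrreducible.apply_last_ne_zero {n : ℕ} {σ : Equiv.Perm (Fin (n + 1))}
    (hσ : rauzyIrreducible σ) (hn : 1 ≤ n) : σ (Fin.last n) ≠ 0 := by
  intro h
  refine hσ n hn (Nat.lt_succ_self n) ?_
  ext y
  simp only [Finset.mem_image, Finset.mem_filter, Finset.mem_univ, true_and]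
  constructor
  · rintro ⟨x, hx, rfl⟩
    have h0 : σ x ≠ 0 := by
      rw [← h, σ.injective.ne_iff]
      exact Fin.ne_of_lt hx
    have := Fin.pos_iff_ne_zero.mpr h0
    rw [Fin.lt_def, Fin.val_zero] at this
    omega
  · intro hy
    refine ⟨σ.symm y, Fin.lt_last_iff_ne_last.mpr fun hlast => ?_, σ.apply_symm_apply y⟩
    rw [Equiv.symm_apply_eq, h] at hlast
    simp [hlast] at hy

/-- For an irreducible permutation: the rank is at least `1`, all parts of `λ` are positive,
and the dimension formula `r + Σ λ_i = n - 1` holds. -/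
theorem dimension_formula {n : ℕ} (hn : 2 ≤ n) (σ : Equiv.Perm (Fin n))
    (hσ : rauzyIrreducible σ) :
    1 ≤ rauzyRank σ ∧ (∀ c ∈ rauzyLambda σ, 0 < c) ∧
      rauzyRank σ + (rauzyLambda σ).sum = n - 1 := by
  obtain ⟨n, rfl⟩ : ∃ m, n = m + 1 := ⟨n - 1, by omega⟩
  have hrank : 1 < Set.ncard {x | (cycleMap σ).SameCycle 0 x} :=
    (Set.one_lt_ncard (Set.toFinite _)).mpr
      ⟨0, Equiv.Perm.SameCycle.refl _ _, cycleMap σ 0, Equiv.Perm.sameCycle_apply_right.mpr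
        (Equiv.Perm.SameCycle.refl _ _), fun h => hσ.apply_last_ne_zero (by omega)
          ((cycleMap_zero_eq_zero_iff σ).mp h.symm)⟩
  refine ⟨by rw [rauzyRank]; omega, fun c hc => ?_, ?_⟩
  · rw [rauzyLambda] at hc
    obtain ⟨j, -, rfl⟩ := Multiset.mem_map.mp hc
    exact (Set.ncard_pos (Set.toFinite _)).mpr ⟨j, Equiv.Perm.SameCycle.refl _ _⟩
  · have hsum : Set.ncard {x | (cycleMap σ).SameCycle 0 x} + (rauzyLambda σ).sum = n + 1 := by
      refine Eq.trans ?_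
        ((ncard_sameCycle_add_sum (cycleMap σ) 0).trans (Fintype.card_fin (n + 1)))
      rw [rauzyLambda, Finset.sum_eq_multiset_sum]
      congr!
    rw [rauzyRank]
    omega

end Rauzy
end

section
/- For every n ≥ 2 and every irreducible permutation σ of {1,…,n}, the multiset λ(σ) ∪ {r(σ)} contains an even number of even entries. -/
open scoped Classical

namespace Rauzy

/-- The minima of the cycles of even length of `π`. -/
noncomputable def evenCycleMinima {α : Type*} [Fintype α] [LinearOrder α] (π : Equiv.Perm α) :
    Finset α :=
  Finset.univ.filter fun j =>
    (∀ x, π.SameCycle j x → j ≤ x) ∧ Even (Set.ncard {x | π.SameCycle j x})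

theorem mem_evenCycleMinima {α : Type*} [Fintype α] [LinearOrder α] {π : Equiv.Perm α} {j : α} :
    j ∈ evenCycleMinima π ↔
      (∀ x, π.SameCycle j x → j ≤ x) ∧ Even (Set.ncard {x | π.SameCycle j x}) := by
  simp [evenCycleMinima]

theorem coe_support_cycleOf {α : Type*} [Fintype α] [DecidableEq α] {π : Equiv.Perm α} {j : α}
    (hj : π j ≠ j) : ((π.cycleOf j).support : Set α) = {x | π.SameCycle j x} := by
  ext x
  simp [Equiv.Perm.mem_support_cycleOf_iff' hj]

theorem ncard_sameCycle_of_fixed {α : Type*} {π : Equiv.Perm α} {j : α} (hj : π j = j) :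
    Set.ncard {x | π.SameCycle j x} = 1 := by
  rw [Set.ncard_eq_one]
  refine ⟨j, Set.ext fun x => ⟨fun ⟨i, hi⟩ => ?_, fun h => ?_⟩⟩
  · rw [Equiv.Perm.zpow_apply_eq_self_of_apply_eq_self hj] at hi
    exact hi.symm
  · obtain rfl : x = j := h
    exact Equiv.Perm.SameCycle.refl _ _

theorem card_evenCycleMinima {α : Type*} [Fintype α] [LinearOrder α] (π : Equiv.Perm α) :
    (evenCycleMinima π).card = (π.cycleFactorsFinset.filter fun c => Even c.support.card).card := by
  have moved {j : α} (hj : j ∈ evenCycleMinima π) : π j ≠ j := by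
    intro h
    have := (mem_evenCycleMinima.1 hj).2
    rw [ncard_sameCycle_of_fixed h] at this
    exact absurd this (by decide)
  refine Finset.card_bij (fun j _ => π.cycleOf j) ?_ ?_ ?_
  · intro j hj
    have hm := moved hj
    refine Finset.mem_filter.2 ⟨?_, ?_⟩
    · rwa [Equiv.Perm.cycleOf_mem_cycleFactorsFinset_iff, Equiv.Perm.mem_support]
    · rw [← Set.ncard_coe_finset, coe_support_cycleOf hm]
      exact (mem_evenCycleMinima.1 hj).2
  · intro i hi j hj hij
    have hs : π.SameCycle i j := by
      have : j ∈ (π.cycleOf i).support := by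
        rw [hij, Equiv.Perm.mem_support_cycleOf_iff' (moved hj)]
      rwa [Equiv.Perm.mem_support_cycleOf_iff' (moved hi)] at this
    exact le_antisymm ((mem_evenCycleMinima.1 hi).1 j hs) ((mem_evenCycleMinima.1 hj).1 i hs.symm)
  · intro c hc
    obtain ⟨hc, he⟩ := Finset.mem_filter.1 hc
    have hne : c.support.Nonempty :=
      (Equiv.Perm.mem_cycleFactorsFinset_iff.1 hc).1.nonempty_support
    have hmem := c.support.min'_mem hne
    have heq := Equiv.Perm.cycle_is_cycleOf hmem hc
    have hm : π (c.support.min' hne) ≠ c.support.min' hne :=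
      Equiv.Perm.mem_support.1 (Equiv.Perm.mem_cycleFactorsFinset_support_le hc hmem)
    have hset := coe_support_cycleOf hm
    rw [← heq] at hset
    refine ⟨c.support.min' hne, mem_evenCycleMinima.2 ⟨?_, ?_⟩, heq.symm⟩
    · intro x hx
      exact c.support.min'_le x (Finset.mem_coe.1 (hset.symm ▸ hx))
    · rwa [← hset, Set.ncard_coe_finset]

theorem sign_eq_neg_one_pow_card_evenCycleMinima {α : Type*} [Fintype α] [LinearOrder α]
    (π : Equiv.Perm α) : Equiv.Perm.sign π = (-1) ^ (evenCycleMinima π).card := by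
  rw [card_evenCycleMinima, Equiv.Perm.sign_of_cycleType', Equiv.Perm.cycleType_def,
    Multiset.map_map, ← Finset.prod_const, Finset.prod_filter]
  refine Finset.prod_congr rfl fun c _ => ?_
  split_ifs with h
  · simp [h.neg_one_pow]
  · simp [(Nat.not_even_iff_odd.1 h).neg_one_pow]

theorem sign_cycleMap {n : ℕ} {σ : Equiv.Perm (Fin (n + 1))} (h : σ 0 ≠ Fin.last n) :
    Equiv.Perm.sign (cycleMap σ) = -1 := by
  have h₁ := Int.units_mul_self (Equiv.Perm.sign (finRotate (n + 1)))
  have h₂ := Int.units_mul_self (Equiv.Perm.sign σ)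
  simp only [cycleMap, Equiv.Perm.sign_mul, Equiv.Perm.sign_swap h, Equiv.Perm.sign_inv]
  generalize Equiv.Perm.sign (finRotate (n + 1)) = a at *
  generalize Equiv.Perm.sign σ = b at *
  calc a * -1 * b * a * b = (a * a) * (b * b) * -1 := by ac_rfl
    _ = -1 := by rw [h₁, h₂]; rfl

theorem rauzyIrreducible.apply_zero_ne_last {n : ℕ} {σ : Equiv.Perm (Fin (n + 1))}
    (hσ : rauzyIrreducible σ) (hn : 1 ≤ n) : σ 0 ≠ Fin.last n := by
  intro h
  refine hσ 1 le_rfl (by omega) (Finset.ext fun x => ?_)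
  simp only [Finset.mem_image, Finset.mem_filter, Finset.mem_univ, true_and]
  constructor
  · rintro ⟨j, hj, rfl⟩
    obtain rfl : j = 0 := Fin.ext (by simpa using hj)
    simp [h]
  · intro hx
    refine ⟨0, by simp, h.trans (Fin.ext ?_)⟩
    simp only [Fin.val_last]
    omega

/-- Among the minima of even cycles, only that of the rank path (of length `r + 1`) is
not counted by `λ`. -/
theorem card_evenCycleMinima_cycleMap {n : ℕ} (σ : Equiv.Perm (Fin (n + 1))) :
    (evenCycleMinima (cycleMap σ)).card =
      Multiset.card ((rauzyLambda σ).filter fun c => Even c) +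
        if Even (rauzyRank σ) then 0 else 1 := by
  have hpos : 0 < Set.ncard {x | (cycleMap σ).SameCycle 0 x} :=
    (Set.ncard_pos).2 ⟨0, Equiv.Perm.SameCycle.refl _ _⟩
  have hrank : ¬ Even (rauzyRank σ) ↔ Even (Set.ncard {x | (cycleMap σ).SameCycle 0 x}) := by
    rw [show Set.ncard {x | (cycleMap σ).SameCycle 0 x} = rauzyRank σ + 1 by
      simp only [rauzyRank]; omega, Nat.even_add_one]
  have hlam : Multiset.card ((rauzyLambda σ).filter fun c => Even c) =
      ((evenCycleMinima (cycleMap σ)).filter fun j => ¬ (cycleMap σ).SameCycle 0 j).card := by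
    rw [rauzyLambda, Multiset.filter_map, Multiset.card_map, ← Finset.filter_val,
      Finset.card_val, evenCycleMinima, Finset.filter_filter, Finset.filter_filter]
    congr 1
    ext j
    simp only [Finset.mem_filter, Function.comp]
    tauto
  have hzero : ((evenCycleMinima (cycleMap σ)).filter fun j => (cycleMap σ).SameCycle 0 j).card =
      if Even (rauzyRank σ) then 0 else 1 := by
    have key (j) (hj : j ∈ evenCycleMinima (cycleMap σ)) (h : (cycleMap σ).SameCycle 0 j) :
        j = 0 := le_antisymm ((mem_evenCycleMinima.1 hj).1 0 h.symm) (Fin.zero_le _)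
    split_ifs with he
    · rw [Finset.card_eq_zero, Finset.filter_eq_empty_iff]
      intro j hj h
      obtain rfl := key j hj h
      exact hrank.2 (mem_evenCycleMinima.1 hj).2 he
    · rw [Finset.card_eq_one]
      refine ⟨0, Finset.ext fun j => ?_⟩
      rw [Finset.mem_filter, Finset.mem_singleton]
      refine ⟨fun h => key j h.1 h.2, ?_⟩
      rintro rfl
      exact ⟨mem_evenCycleMinima.2 ⟨fun x _ => Fin.zero_le x, hrank.1 he⟩,
        Equiv.Perm.SameCycle.refl _ _⟩
  rw [hlam, ← hzero, Nat.add_comm (Finset.card _), Finset.card_filter_add_card_filter_not]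

/-- The list `λ ∪ {r}` has an even number of even entries. -/
theorem even_number_of_even_entries {n : ℕ} (hn : 2 ≤ n) (σ : Equiv.Perm (Fin n))
    (hσ : rauzyIrreducible σ) :
    Even (Multiset.card ((rauzyRank σ ::ₘ rauzyLambda σ).filter fun c => Even c)) := by
  obtain _ | n := n
  · omega
  have hs := sign_cycleMap (hσ.apply_zero_ne_last (by omega))
  rw [sign_eq_neg_one_pow_card_evenCycleMinima] at hs
  have hodd : Odd (evenCycleMinima (cycleMap σ)).card := by
    by_contra h
    rw [(Nat.not_odd_iff_even.1 h).neg_one_pow] at hs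
    exact absurd hs (by decide)
  rw [card_evenCycleMinima_cycleMap] at hodd
  by_cases h : Even (rauzyRank σ)
  · rw [Multiset.filter_cons_of_pos _ h, Multiset.card_cons]
    rw [if_pos h, add_zero] at hodd
    exact hodd.add_one
  · rw [Multiset.filter_cons_of_neg _ h]
    rw [if_neg h, Nat.odd_add_one, Nat.not_odd_iff_even] at hodd
    exact hodd

end Rauzy
end

section
/- For every n ≥ 1 and every irreducible permutation σ of {1,…,n}, one has Ā(L(σ)) = Ā(σ) and Ā(R(σ)) = Ā(σ). Hence the Arf invariant Ā (and the sign s) is constant on each Rauzy class. -/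
open scoped Classical

namespace Rauzy

/-- One step of the Rauzy dynamics: apply `L` or `R`. -/
def rauzyStep {n : ℕ} (σ τ : Equiv.Perm (Fin n)) : Prop :=
  τ = rauzyL σ ∨ τ = rauzyR σ

/-- `τ` is obtained from `σ` by a finite sequence of applications of `L` and `R`. -/
def rauzyReach {n : ℕ} (σ τ : Equiv.Perm (Fin n)) : Prop :=
  Relation.ReflTransGen rauzyStep σ τ

/-- Two permutations are connected (are in the same Rauzy class) if one can be obtained
from the other by a finite sequence of applications of `L` and `R`. -/
def rauzyConnected {n : ℕ} (σ τ : Equiv.Perm (Fin n)) : Prop :=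
  rauzyReach σ τ ∨ rauzyReach τ σ

/-- `χ_I(σ)`: the number of pairs of non-crossing edges of `σ` with both endpoints in `I`. -/
def chiSet {n : ℕ} (σ : Equiv.Perm (Fin n)) (I : Finset (Fin n)) : ℕ :=
  ((I ×ˢ I).filter fun pr => pr.1 < pr.2 ∧ σ pr.1 < σ pr.2).card

/-- `A(σ) = Σ_{I ⊆ [n]} (-1)^{χ_I(σ)}`. -/
def arfA {n : ℕ} (σ : Equiv.Perm (Fin n)) : ℤ :=
  ∑ I : Finset (Fin n), (-1 : ℤ) ^ (chiSet σ I)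

/-- The Arf invariant `Ā(σ) = Σ_{I ⊆ [n]} (-1)^{|I| + χ_I(σ)}`. -/
def arfBar {n : ℕ} (σ : Equiv.Perm (Fin n)) : ℤ :=
  ∑ I : Finset (Fin n), (-1 : ℤ) ^ (I.card + chiSet σ I)

/-- The sign `s(σ) ∈ {-1, 0, +1}` of the Arf invariant. -/
def arfSign {n : ℕ} (σ : Equiv.Perm (Fin n)) : ℤ := Int.sign (arfBar σ)

theorem val_finRotate {m : ℕ} (x : Fin m) :
    (finRotate m x).val = if x.val + 1 = m then 0 else x.val + 1 := by
  cases m with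
  | zero => exact x.elim0
  | succ m =>
    rw [coe_finRotate]
    simp [Fin.ext_iff]

theorem val_finRotate_inv {m : ℕ} (x : Fin m) :
    ((finRotate m)⁻¹ x).val = if x.val = 0 then m - 1 else x.val - 1 := by
  change ((finRotate m).symm x).val = _
  have h := val_finRotate ((finRotate m).symm x)
  rw [Equiv.apply_symm_apply] at h
  have hlt := ((finRotate m).symm x).isLt
  split_ifs at h ⊢ <;> omega

theorem val_rotDownBelow {n i : ℕ} (h : i ≤ n) (x : Fin n) :
    (rotDownBelow n i h x).val =
      if x.val < i then (if x.val = 0 then i - 1 else x.val - 1) else x.val := by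
  unfold rotDownBelow
  by_cases hx : x.val < i
  · rw [Equiv.Perm.extendDomain_apply_subtype _ (blockEquiv n i h) (b := x) hx, if_pos hx]
    simp only [blockEquiv, Equiv.coe_fn_mk, Equiv.coe_fn_symm_mk, val_finRotate_inv]
  · rw [Equiv.Perm.extendDomain_apply_not_subtype _ (blockEquiv n i h) (b := x) hx, if_neg hx]

theorem val_rotDownFrom_inv {n a : ℕ} (h : a ≤ n) (x : Fin n) :
    ((rotDownFrom n a h)⁻¹ x).val =
      if a ≤ x.val then (if x.val + 1 = n then a else x.val + 1) else x.val := by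
  unfold rotDownFrom
  rw [Equiv.Perm.extendDomain_inv, inv_inv]
  by_cases hx : a ≤ x.val
  · rw [Equiv.Perm.extendDomain_apply_subtype _ (tailEquiv n a h) (b := x) hx, if_pos hx]
    have hx' := x.isLt
    simp only [tailEquiv, Equiv.coe_fn_mk, Equiv.coe_fn_symm_mk, val_finRotate]
    split_ifs <;> omega
  · rw [Equiv.Perm.extendDomain_apply_not_subtype _ (tailEquiv n a h) (b := x) hx, if_neg hx]

section Pairs

variable {V : Type*}

/-- The number of ordered pairs of elements of `I` related by `r`. -/
noncomputable def pairCount (r : V → V → Prop) (I : Finset V) : ℕ :=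
  ((I ×ˢ I).filter fun p => r p.1 p.2).card

theorem pairCount_insert {r : V → V → Prop} (hr : ∀ x y, r x y → ¬ r y x) {x : V}
    {J : Finset V} (hx : x ∉ J) :
    pairCount r (insert x J) = pairCount r J + (J.filter fun y => r x y ∨ r y x).card := by
  have hxx : ¬ r x x := fun h => hr x x h h
  have hdisj : Disjoint (J.filter fun y => r x y) (J.filter fun y => r y x) :=
    Finset.disjoint_filter.2 fun y _ h => hr x y h
  rw [Finset.filter_or, Finset.card_union_of_disjoint hdisj]
  simp only [pairCount, Finset.card_filter, Finset.sum_product, Finset.sum_insert hx,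
    Finset.sum_add_distrib, if_neg hxx]
  omega

theorem neg_one_pow_card_filter_xor {P Q S : V → Prop} [DecidablePred P]
    [DecidablePred Q] [DecidablePred S] {J : Finset V}
    (h : ∀ y ∈ J, S y ↔ Xor (P y) (Q y)) :
    (-1 : ℤ) ^ (J.filter S).card = (-1) ^ (J.filter P).card * (-1) ^ (J.filter Q).card := by
  simp only [← Finset.prod_const, Finset.prod_filter, ← Finset.prod_mul_distrib]
  refine Finset.prod_congr rfl fun y hy => ?_
  have := h y hy
  by_cases hP : P y <;> by_cases hQ : Q y <;> simp_all

/-- Adding the element `e` to the subsets containing `f` (modulo 2) is a transvection which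
carries the quadratic form of `r` to that of `r'`. -/
theorem sum_neg_one_pow_pairCount_eq [Fintype V] {r r' : V → V → Prop}
    (hr : ∀ x y, r x y → ¬ r y x) (hr' : ∀ x y, r' x y → ¬ r' y x) {e f : V} (hef : e ≠ f)
    (hrr' : ∀ x y, x ≠ f → y ≠ f → (r' x y ↔ r x y))
    (he : r e f ∨ r f e) (he' : r' e f ∨ r' f e)
    (hf : ∀ y, y ≠ e → y ≠ f → ((r' f y ∨ r' y f) ↔ Xor (r f y ∨ r y f) (r e y ∨ r y e))) :
    ∑ I : Finset V, (-1 : ℤ) ^ (I.card + pairCount r' I) =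
      ∑ I : Finset V, (-1 : ℤ) ^ (I.card + pairCount r I) := by
  have key : ∀ J : Finset V, f ∉ J → pairCount r' J = pairCount r J := fun J hJ => by
    unfold pairCount
    congr 1
    refine Finset.filter_congr fun p hp => ?_
    rw [Finset.mem_product] at hp
    exact hrr' _ _ (ne_of_mem_of_not_mem hp.1 hJ) (ne_of_mem_of_not_mem hp.2 hJ)
  have two : ∀ J : Finset V, e ∉ J → f ∉ J →
      (-1 : ℤ) ^ ((insert f J).card + pairCount r' (insert f J)) =
        (-1) ^ ((insert e (insert f J)).card + pairCount r (insert e (insert f J))) ∧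
      (-1 : ℤ) ^ ((insert e (insert f J)).card + pairCount r' (insert e (insert f J))) =
        (-1) ^ ((insert f J).card + pairCount r (insert f J)) := fun J heJ hfJ => by
    have heI : e ∉ insert f J := by simp [hef, heJ]
    have hx := neg_one_pow_card_filter_xor (J := J) (S := fun y => r' f y ∨ r' y f)
      (P := fun y => r f y ∨ r y f) (Q := fun y => r e y ∨ r y e)
      fun y hy => hf y (ne_of_mem_of_not_mem hy heJ) (ne_of_mem_of_not_mem hy hfJ)
    have hc : J.filter (fun y => r' e y ∨ r' y e) = J.filter fun y => r e y ∨ r y e :=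
      Finset.filter_congr fun y hy => by
        have hy' := ne_of_mem_of_not_mem hy hfJ
        rw [hrr' _ _ hef hy', hrr' _ _ hy' hef]
    have hsq : ((-1 : ℤ) ^ (J.filter fun y => r e y ∨ r y e).card) ^ 2 = 1 := by
      rw [← pow_mul, mul_comm, pow_mul]; simp
    rw [pairCount_insert hr heI, pairCount_insert hr' heI, pairCount_insert hr hfJ,
      pairCount_insert hr' hfJ, Finset.filter_insert, Finset.filter_insert, if_pos he,
      if_pos he', hc, Finset.card_insert_of_notMem (s := J.filter _) (by simp [hfJ]),
      Finset.card_insert_of_notMem heI, Finset.card_insert_of_notMem hfJ, key J hfJ]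
    simp only [pow_add, hx]
    constructor
    · ring
    · linear_combination (-(-1 : ℤ) ^ J.card * (-1) ^ pairCount r J *
        (-1) ^ (J.filter fun y => r f y ∨ r y f).card) * hsq
  let φ : Finset V → Finset V := fun I =>
    if f ∈ I then (if e ∈ I then I.erase e else insert e I) else I
  have hφ : Function.Involutive φ := fun I => by
    by_cases hfI : f ∈ I
    · by_cases heI : e ∈ I
      · simp [φ, hfI, heI, hef.symm]
      · simp [φ, hfI, heI]
    · simp [φ, hfI]
  refine Fintype.sum_equiv hφ.toPerm _ _ fun I => ?_
  change _ = (-1 : ℤ) ^ ((φ I).card + pairCount r (φ I))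
  by_cases hfI : f ∈ I
  · have hI : insert f ((I.erase e).erase f) = I.erase e :=
      Finset.insert_erase (Finset.mem_erase.2 ⟨hef.symm, hfI⟩)
    have h2 := two ((I.erase e).erase f) (by simp) (by simp)
    rw [hI] at h2
    by_cases heI : e ∈ I
    · simpa [φ, hfI, heI] using h2.2
    · simpa [φ, hfI, heI] using h2.1
  · simp [φ, hfI, key I hfI]

end Pairs

theorem arfBar_eq_sum_pairCount {n : ℕ} (σ : Equiv.Perm (Fin n)) :
    arfBar σ = ∑ I : Finset (Fin n),
      (-1 : ℤ) ^ (I.card + pairCount (fun x y => x < y ∧ σ x < σ y) I) := by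
  unfold arfBar chiSet pairCount
  refine Finset.sum_congr rfl fun I _ => ?_
  congr!

theorem arfBar_mul_eq_sum_pairCount {n : ℕ} (σ δ : Equiv.Perm (Fin n)) :
    arfBar (σ * δ) = ∑ I : Finset (Fin n),
      (-1 : ℤ) ^ (I.card + pairCount (fun x y => δ⁻¹ x < δ⁻¹ y ∧ σ x < σ y) I) := by
  rw [arfBar_eq_sum_pairCount]
  refine Fintype.sum_equiv (Equiv.finsetCongr δ) _ _ fun I => ?_
  simp only [pairCount, Finset.card_filter, Finset.sum_product]
  simp [-Finset.sum_boole]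
  congr!

theorem arfBar_rauzyL {n : ℕ} (σ : Equiv.Perm (Fin n)) : arfBar (rauzyL σ) = arfBar σ := by
  unfold rauzyL
  split_ifs with hn
  swap
  · rfl
  obtain ⟨e, he⟩ : ∃ e : Fin n, ⟨n - 1, by omega⟩ = e := ⟨_, rfl⟩
  simp only [he]
  have hv := fun x => val_rotDownBelow (σ e).isLt.le (σ x)
  have hev : e.val = n - 1 := by rw [← he]
  have hpos : ∀ x : Fin n, x.val ≤ e.val := fun x => by omega
  obtain ⟨f, hf⟩ : ∃ f, σ f = ⟨0, hn⟩ := σ.surjective _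
  by_cases hef : e = f
  · congr 1
    ext x
    rw [Equiv.Perm.mul_apply, hv]
    simp [hef, hf]
  have hinj : ∀ x y, (σ x).val = (σ y).val → x = y := fun x y h => σ.injective (Fin.ext h)
  have hf0 : (σ f).val = 0 := by rw [hf]
  have hfe : f.val < e.val := lt_of_le_of_ne (hpos f) fun h => hef (Fin.ext h.symm)
  have hpe : 0 < (σ e).val := Nat.pos_of_ne_zero fun h => hef (hinj _ _ (h.trans hf0.symm))
  rw [arfBar_eq_sum_pairCount, arfBar_eq_sum_pairCount]
  refine sum_neg_one_pow_pairCount_eq (e := e) (f := f) (fun x y h h' => lt_asymm h.1 h'.1)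
    (fun x y h h' => lt_asymm h.1 h'.1) hef ?_ ?_ ?_ ?_
  · intro x y hx hy
    have hx0 : (σ x).val ≠ 0 := fun h => hx (hinj _ _ (h.trans hf0.symm))
    have hy0 : (σ y).val ≠ 0 := fun h => hy (hinj _ _ (h.trans hf0.symm))
    simp only [Equiv.Perm.mul_apply, Fin.lt_def, hv]
    split_ifs <;> omega
  · simp only [Fin.lt_def]
    omega
  · simp only [Equiv.Perm.mul_apply, Fin.lt_def, hv]
    split_ifs <;> omega
  · intro y hye hyf
    have hy0 : (σ y).val ≠ 0 := fun h => hyf (hinj _ _ (h.trans hf0.symm))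
    have hye' : (σ y).val ≠ (σ e).val := fun h => hye (hinj _ _ h)
    have hy1 : y.val < e.val := lt_of_le_of_ne (hpos y) fun h => hye (Fin.ext h)
    have hy2 : y.val ≠ f.val := fun h => hyf (Fin.ext h)
    simp only [Equiv.Perm.mul_apply, Fin.lt_def, hv, xor_iff_iff_not]
    split_ifs <;> omega

theorem arfBar_rauzyR {n : ℕ} (σ : Equiv.Perm (Fin n)) : arfBar (rauzyR σ) = arfBar σ := by
  unfold rauzyR
  split_ifs with hn
  swap
  · rfl
  set e : Fin n := σ⁻¹ ⟨0, hn⟩ with he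
  have hv := fun x => val_rotDownFrom_inv (n := n) (a := e.val + 1) e.isLt x
  set δ := rotDownFrom n (e.val + 1) e.isLt
  have he0 : (σ e).val = 0 := by simp [he]
  have hinj : ∀ x y, (σ x).val = (σ y).val → x = y := fun x y h => σ.injective (Fin.ext h)
  have hpos : ∀ x : Fin n, x.val < n := fun x => x.isLt
  obtain ⟨f, hf⟩ : ∃ f : Fin n, f.val = n - 1 := ⟨⟨n - 1, by omega⟩, rfl⟩
  rw [arfBar_mul_eq_sum_pairCount, arfBar_eq_sum_pairCount]
  by_cases hef : e = f
  · have hδ : ∀ x, δ⁻¹ x = x := fun x => by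
      have := hpos x
      apply Fin.ext
      rw [hv, if_neg (by rw [hef]; omega)]
    simp only [hδ]
  have hlt : e.val < n - 1 := by
    have h1 := hpos e
    have h2 : e.val ≠ f.val := fun h => hef (Fin.ext h)
    omega
  have hpf : 0 < (σ f).val := Nat.pos_of_ne_zero fun h => hef (hinj _ _ (he0.trans h.symm))
  refine sum_neg_one_pow_pairCount_eq (e := e) (f := f) (fun x y h h' => lt_asymm h.1 h'.1)
    (fun x y h h' => lt_asymm h.1 h'.1) hef ?_ ?_ ?_ ?_
  · intro x y hx hy
    have hx0 : x.val ≠ f.val := fun h => hx (Fin.ext h)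
    have hy0 : y.val ≠ f.val := fun h => hy (Fin.ext h)
    have hx1 := hpos x
    have hy1 := hpos y
    simp only [Fin.lt_def, hv]
    split_ifs <;> omega
  · simp only [Fin.lt_def]
    omega
  · simp only [Fin.lt_def, hv]
    split_ifs <;> omega
  · intro y hye hyf
    have hy0 : (σ y).val ≠ 0 := fun h => hye (hinj _ _ (h.trans he0.symm))
    have hyf' : (σ y).val ≠ (σ f).val := fun h => hyf (hinj _ _ h)
    have hy1 : y.val ≠ e.val := fun h => hye (Fin.ext h)
    have hy2 : y.val ≠ f.val := fun h => hyf (Fin.ext h)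
    have hy3 := hpos y
    simp only [Fin.lt_def, hv, xor_iff_iff_not]
    split_ifs <;> omega

theorem arfBar_eq_of_rauzyReach {n : ℕ} {σ τ : Equiv.Perm (Fin n)} (h : rauzyReach σ τ) :
    arfBar σ = arfBar τ := by
  induction h with
  | refl => rfl
  | tail _ hstep ih =>
    rcases hstep with rfl | rfl
    · rw [ih, arfBar_rauzyL]
    · rw [ih, arfBar_rauzyR]

/-- The Arf invariant `Ā` is preserved by the Rauzy operators `L` and `R`; hence `Ā` (and
the sign `s`) is constant on each Rauzy class. -/
theorem arf_invariant_invariant {n : ℕ} (hn : 1 ≤ n) :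
    (∀ σ : Equiv.Perm (Fin n), rauzyIrreducible σ →
      arfBar (rauzyL σ) = arfBar σ ∧ arfBar (rauzyR σ) = arfBar σ) ∧
    (∀ σ τ : Equiv.Perm (Fin n), rauzyIrreducible σ → rauzyIrreducible τ →
      rauzyConnected σ τ → arfBar σ = arfBar τ ∧ arfSign σ = arfSign τ) := by
  have arf : ∀ σ τ : Equiv.Perm (Fin n), rauzyConnected σ τ → arfBar σ = arfBar τ :=
    fun σ τ h => h.elim arfBar_eq_of_rauzyReach fun h => (arfBar_eq_of_rauzyReach h).symm
  refine ⟨fun σ _ => ⟨arfBar_rauzyL σ, arfBar_rauzyR σ⟩, fun σ τ _ _ h => ⟨arf σ τ h, ?_⟩⟩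
  rw [arfSign, arfSign, arf σ τ h]

end Rauzy
end
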